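/- arXiv:1902.08930 — 4 statements merged into one kernel-verified Lean document; each statement's English description precedes it below -/
import Mathlib

section
/- Let A be a set of m alternatives and D a nonempty family of subsets of L(A); let K = max_{S∈D} |S|. For every n divisible by m!, let U_n be the profile consisting of n/m! copies of each of the m! orders in L(A). Then: (a) the preference-distance of U_n from D is at most (1 − K/m!)·n; (b) an ℓ-sample drawn from U_n is distributed exactly as ℓ independent uniformly random elements of L(A); hence (c) for every ℓ and every function f : L(A)^ℓ → {0,1}, the probability that f outputs 1 on an ℓ-sample from U_n plus the probability that f outputs 0 on an ℓ-tuple of i.i.d. uniform elements of L(A) equals 1. In particular, for every ε_v ≥ 1 − K/m! and every δ < 1/2, no function f can simultaneously output 1 with probability at least 1−δ on an ℓ-sample from every fixed profile of preference-distance at most ε_v·n from D, and output 0 with probability at least 1−δ on ℓ i.i.d. uniform orders. -/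
/-- A strict linear order on `A`, encoded as a Boolean relation. -/
def IsLinOrd {A : Type*} (r : A → A → Bool) : Prop :=
  (∀ a, ¬ r a a) ∧ (∀ a b c, r a b → r b c → r a c) ∧ (∀ a b, a ≠ b → r a b ∨ r b a)

instance IsLinOrd.decPred {A : Type*} [Fintype A] [DecidableEq A] :
    DecidablePred (@IsLinOrd A) := fun r => by
  unfold IsLinOrd; infer_instance

/-- A preference: a strict linear order on the set `A` of alternatives. -/
abbrev Pref (A : Type*) := {r : A → A → Bool // IsLinOrd r}

/-- Restriction of a preference to a subset `X` of the alternatives. -/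
def Pref.restrict {A : Type*} (r : Pref A) (X : Finset A) : Pref {a // a ∈ X} :=
  ⟨fun u v => r.1 u.1 v.1, by
    obtain ⟨h1, h2, h3⟩ := r.2
    exact ⟨fun u => h1 u.1, fun u v w => h2 u.1 v.1 w.1,
      fun u v huv => h3 u.1 v.1 (fun h => huv (Subtype.ext h))⟩⟩

/-- `r` is single-peaked with respect to the societal axis `ax`. -/
def SinglePeakedWrt {A : Type*} (ax r : Pref A) : Prop :=
  ∀ t : A, (∀ z, z ≠ t → r.1 t z) → ∀ u v : A,
    (((ax.1 t u ∧ ax.1 u v) ∨ (ax.1 v u ∧ ax.1 u t)) ∨ (u = t ∧ v ≠ t)) → r.1 u v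

/-- A profile is single-peaked if there is a single axis w.r.t. which every preference
of the profile is single-peaked. -/
def IsSinglePeaked {A ι : Type*} (P : ι → Pref A) : Prop :=
  ∃ ax : Pref A, ∀ i, SinglePeakedWrt ax (P i)

/-- A profile (in its given order) is single-crossing: for each ordered pair of
alternatives, the relative order changes at most once along the sequence. -/
def SingleCrossingInOrder {A : Type*} {n : ℕ} (P : Fin n → Pref A) : Prop :=
  ∀ a b : A, ∀ i j k : Fin n, i ≤ j → j ≤ k → (P i).1 a b → (P k).1 a b → (P j).1 a b

/-- A profile is single-crossing if some reordering of its preferences is single-crossing. -/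
def IsSingleCrossing {A ι : Type*} [Fintype ι] (P : ι → Pref A) : Prop :=
  ∃ e : Fin (Fintype.card ι) ≃ ι, SingleCrossingInOrder (fun i => P (e i))

/-- Probability of an event under the uniform distribution on a finite sample space. -/
noncomputable def pr {Ω : Type*} [Fintype Ω] (E : Ω → Prop) : ℝ :=
  haveI := Classical.decPred E
  ((Finset.univ.filter E).card : ℝ) / (Fintype.card Ω : ℝ)

/-- Number of occurrences of the order `q` in the tuple `S` of preferences. -/
noncomputable def countPref {A : Type*} {ℓ : ℕ} (S : Fin ℓ → Pref A) (q : Pref A) : ℕ :=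
  haveI : DecidableEq (Pref A) := Classical.decEq _
  (Finset.univ.filter (fun j => S j = q)).card

/-- Preference-distance of a profile from a domain `D`: `n` minus the maximum size of
an index set whose subprofile lies in a single member of `D`. -/
noncomputable def prefDist {A : Type*} {n : ℕ} (D : Finset (Finset (Pref A)))
    (P : Fin n → Pref A) : ℕ :=
  haveI := Classical.decPred (fun J : Finset (Fin n) => ∃ S ∈ D, ∀ i ∈ J, P i ∈ S)
  n - ((Finset.univ : Finset (Finset (Fin n))).filter
        (fun J => ∃ S ∈ D, ∀ i ∈ J, P i ∈ S)).sup Finset.card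

/-- The preference ranking the alternatives by their position under `e`. -/
def prefOfEquiv {A : Type*} {n : ℕ} (e : A ≃ Fin n) : Pref A :=
  ⟨fun a b => decide (e a < e b), by simp, by simpa using fun a b c => lt_trans,
    by simp⟩

theorem prefOfEquiv_bijective {A : Type*} [Fintype A] {n : ℕ} (hn : Fintype.card A = n) :
    Function.Bijective (prefOfEquiv : (A ≃ Fin n) → Pref A) := by
  constructor
  · intro e e' h
    have hlt : ∀ a b, e a < e b ↔ e' a < e' b := fun a b => by
      have := congrFun (congrFun (congrArg Subtype.val h) a) b
      simpa [prefOfEquiv] using this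
    let o : Fin n ≃o Fin n :=
      { toEquiv := e.symm.trans e'
        map_rel_iff' := by
          intro x y
          have := hlt (e.symm y) (e.symm x)
          simp only [Equiv.apply_symm_apply] at this
          simp only [Equiv.trans_apply, ← not_lt, this] }
    have ho : o = OrderIso.refl _ := Subsingleton.elim _ _
    ext a
    have := congrArg (fun f : Fin n ≃o Fin n => f (e a)) ho
    simp only [OrderIso.refl_apply] at this
    rw [← this]
    simp [o]
  · rintro ⟨r, h1, h2, h3⟩
    classical
    have : IsStrictTotalOrder A (fun a b => r a b = true) :=
      { trichotomous := fun a b hab hba => by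
          by_contra hne
          exact (h3 a b hne).elim hab hba
        irrefl := h1
        trans := h2 }
    let : LinearOrder A := linearOrderOfSTO (fun a b => r a b = true)
    let o := Fintype.orderIsoFinOfCardEq A hn
    refine ⟨o.symm.toEquiv, Subtype.ext ?_⟩
    funext a b
    have : (o.symm a < o.symm b) ↔ r a b = true := o.symm.lt_iff_lt
    rw [Bool.eq_iff_iff]
    simpa [prefOfEquiv] using this

theorem card_pref {A : Type*} [Fintype A] [DecidableEq A] :
    Fintype.card (Pref A) = (Fintype.card A).factorial := by
  rw [← Fintype.card_congr (Equiv.ofBijective _ (prefOfEquiv_bijective (A := A) rfl))]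
  exact Fintype.card_equiv (Fintype.equivFin A)

theorem pr_eq_natCard {Ω : Type*} [Fintype Ω] (E : Ω → Prop) :
    pr E = (Nat.card {x // E x} : ℝ) / Nat.card Ω := by
  classical
  rw [pr, Nat.card_eq_fintype_card, Nat.card_eq_fintype_card, Fintype.card_subtype]

theorem pr_comp_equiv {Ω Ω' : Type*} [Fintype Ω] [Fintype Ω'] (e : Ω ≃ Ω') (E : Ω' → Prop) :
    pr (fun x => E (e x)) = pr E := by
  rw [pr_eq_natCard, pr_eq_natCard, Nat.card_congr e,
    Nat.card_congr (e.subtypeEquiv (p := fun x => E (e x)) (q := E) fun _ => Iff.rfl)]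

theorem pr_comp_fst {Ω Ω' : Type*} [Fintype Ω] [Fintype Ω'] [Nonempty Ω'] (E : Ω → Prop) :
    pr (fun x : Ω × Ω' => E x.1) = pr E := by
  let e : {x : Ω × Ω' // E x.1} ≃ {x // E x} × Ω' :=
    { toFun := fun x => (⟨x.1.1, x.2⟩, x.1.2)
      invFun := fun x => ⟨(x.1.1, x.2), x.1.2⟩
      left_inv := fun _ => rfl
      right_inv := fun _ => rfl }
  rw [pr_eq_natCard, pr_eq_natCard, Nat.card_congr e, Nat.card_prod, Nat.card_prod]
  push_cast
  exact mul_div_mul_right _ _ (Nat.cast_ne_zero.mpr Nat.card_pos.ne')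

theorem pr_true_add_pr_false {Ω : Type*} [Fintype Ω] [Nonempty Ω] (f : Ω → Bool) :
    pr (fun x => f x = true) + pr (fun x => f x = false) = 1 := by
  classical
  have h := Finset.card_filter_add_card_filter_not (s := (Finset.univ : Finset Ω))
    (fun x => f x = true)
  simp only [Bool.not_eq_true, Finset.card_univ] at h
  have h0 : (Fintype.card Ω : ℝ) ≠ 0 := Nat.cast_ne_zero.mpr Fintype.card_ne_zero
  rw [pr, pr, ← add_div, div_eq_one_iff_eq h0, ← h]
  push_cast
  congr!

theorem prefDist_le_sub_card {A : Type*} {n : ℕ} {D : Finset (Finset (Pref A))}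
    {P : Fin n → Pref A} {S : Finset (Pref A)} (hS : S ∈ D) {J : Finset (Fin n)}
    (hJ : ∀ i ∈ J, P i ∈ S) : prefDist D P ≤ n - J.card := by
  classical
  unfold prefDist
  refine Nat.sub_le_sub_left (Finset.le_sup (f := Finset.card) ?_) n
  simpa using ⟨S, hS, hJ⟩


/-- the balanced profile `U_n` (each of the `m!` orders `n/m!` times) has
preference-distance at most `(1 - K/m!)·n` from `D`, its samples are exactly i.i.d.
uniform, and hence no tester can work for `ε_v ≥ 1 - K/m!`. -/
theorem stmt_3 {A : Type*} [Fintype A] [DecidableEq A] (m : ℕ) (hm : Fintype.card A = m)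
    (D : Finset (Finset (Pref A))) (K : ℕ) (hD : D.Nonempty)
    (hK1 : ∀ S ∈ D, S.card ≤ K) (hK2 : ∃ S ∈ D, S.card = K) :
    ∀ n : ℕ, 1 ≤ n → Nat.factorial m ∣ n →
    ∃ U : Fin n → Pref A,
      (∀ q : Pref A, countPref U q = n / Nat.factorial m) ∧
      ((prefDist D U : ℝ) ≤ (1 - (K : ℝ) / Nat.factorial m) * n) ∧
      (∀ (ℓ : ℕ) (E : (Fin ℓ → Pref A) → Prop),
        pr (fun σ : Fin ℓ → Fin n => E (fun j => U (σ j))) =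
          pr (fun g : Fin ℓ → Pref A => E g)) ∧
      (∀ (ℓ : ℕ) (f : (Fin ℓ → Pref A) → Bool),
        pr (fun σ : Fin ℓ → Fin n => f (fun j => U (σ j)) = true) +
          pr (fun g : Fin ℓ → Pref A => f g = false) = 1) ∧
      (∀ (εv δ : ℝ), 1 - (K : ℝ) / Nat.factorial m ≤ εv → δ < 1/2 →
        ∀ (ℓ : ℕ) (f : (Fin ℓ → Pref A) → Bool),
        ¬((∀ P : Fin n → Pref A, (prefDist D P : ℝ) ≤ εv * n →
            1 - δ ≤ pr (fun σ : Fin ℓ → Fin n => f (fun j => P (σ j)) = true)) ∧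
          1 - δ ≤ pr (fun g : Fin ℓ → Pref A => f g = false))) := by
  intro n hn hdvd
  classical
  obtain ⟨k, rfl⟩ := hdvd
  have hm0 : 0 < m.factorial := m.factorial_pos
  have hk : 0 < k := Nat.pos_of_mul_pos_left hn
  have : NeZero k := ⟨hk.ne'⟩
  have hcard : Fintype.card (Pref A) = m.factorial := by rw [card_pref, hm]
  have : Nonempty (Pref A) := Fintype.card_pos_iff.mp (hcard ▸ hm0)
  let e : Fin (m.factorial * k) ≃ Pref A × Fin k :=
    Fintype.equivOfCardEq (by simp [hcard])
  let U : Fin (m.factorial * k) → Pref A := fun i => (e i).1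
  have hfib : ∀ S : Finset (Pref A),
      (Finset.univ.filter fun i => U i ∈ S).card = S.card * k := by
    intro S
    have : (Finset.univ.filter fun i => U i ∈ S).map e.toEmbedding
        = S ×ˢ (Finset.univ : Finset (Fin k)) := by
      ext x
      simp only [Finset.mem_map_equiv, Finset.mem_filter, Finset.mem_univ, true_and,
        Finset.mem_product, and_true, U, Equiv.apply_symm_apply]
    rw [← Finset.card_map e.toEmbedding, this, Finset.card_product, Finset.card_univ,
      Fintype.card_fin]
  have hdist : (prefDist D U : ℝ) ≤
      (1 - (K : ℝ) / m.factorial) * ((m.factorial * k : ℕ) : ℝ) := by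
    obtain ⟨S, hS, rfl⟩ := hK2
    have h := prefDist_le_sub_card (P := U) hS
      (J := Finset.univ.filter fun i => U i ∈ S) fun i hi => (Finset.mem_filter.mp hi).2
    rw [hfib] at h
    have hle : S.card * k ≤ m.factorial * k :=
      Nat.mul_le_mul_right k (hcard ▸ Finset.card_le_univ S)
    have h' : (prefDist D U : ℝ) ≤ ((m.factorial * k - S.card * k : ℕ) : ℝ) := by
      exact_mod_cast h
    refine h'.trans_eq ?_
    rw [Nat.cast_sub hle]
    push_cast
    field_simp
  have hsample : ∀ (ℓ : ℕ) (E : (Fin ℓ → Pref A) → Prop),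
      pr (fun σ : Fin ℓ → Fin (m.factorial * k) => E (fun j => U (σ j))) =
        pr (fun g : Fin ℓ → Pref A => E g) := by
    intro ℓ E
    rw [← pr_comp_fst (Ω' := Fin ℓ → Fin k) E]
    exact pr_comp_equiv ((Equiv.arrowCongr (Equiv.refl (Fin ℓ)) e).trans
      (Equiv.arrowProdEquivProdArrow (Fin ℓ) (fun _ => Pref A) (fun _ => Fin k)))
      (fun x => E x.1)
  have hsum : ∀ (ℓ : ℕ) (f : (Fin ℓ → Pref A) → Bool),
      pr (fun σ : Fin ℓ → Fin (m.factorial * k) => f (fun j => U (σ j)) = true) +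
        pr (fun g : Fin ℓ → Pref A => f g = false) = 1 := by
    intro ℓ f
    rw [hsample ℓ fun g => f g = true]
    exact pr_true_add_pr_false f
  refine ⟨U, fun q => ?_, hdist, hsample, hsum, ?_⟩
  · have h := hfib {q}
    simp only [Finset.mem_singleton, Finset.card_singleton, one_mul] at h
    rw [Nat.mul_div_cancel_left k hm0]
    convert h using 1
    unfold countPref
    congr!
  · rintro εv δ hε hδ ℓ f ⟨h1, h2⟩
    have h3 := h1 U (hdist.trans (mul_le_mul_of_nonneg_right hε (Nat.cast_nonneg _)))
    have h4 := hsum ℓ f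
    linarith
end

section
/- Let A be a finite set of m ≥ 2 alternatives, D a nonempty family of subsets of L(A) each of cardinality at most K (with K ≥ 1), and P = (≻_1,…,≻_n) a profile whose preference-distance from D equals εn for some 0 < ε < 1. Let 0 < Δ < min{ε, 1−ε}, 0 < δ < 1, and let ℓ ≥ (4/Δ²)·(K·m·ln m + ln(1/δ)). If P′ = (≻′_1,…,≻′_ℓ) is an ℓ-sample from P (each ≻′_i drawn independently and uniformly at random with replacement from the n preferences of P), then with probability at least 1−δ the preference-distance of P′ from D is at least (ε−Δ)ℓ and at most (ε+Δ)ℓ. -/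
/-- Every profile loses at least the preferences outside a given member of the domain. -/
lemma prefDist_add_card_le {A : Type*} {n : ℕ} [DecidableEq (Pref A)]
    (D : Finset (Finset (Pref A))) (P : Fin n → Pref A) {S : Finset (Pref A)} (hS : S ∈ D) :
    prefDist D P + (Finset.univ.filter (fun i => P i ∈ S)).card ≤ n := by
  classical
  unfold prefDist
  have h1 : (Finset.univ.filter (fun i => P i ∈ S)).card ≤
      ((Finset.univ : Finset (Finset (Fin n))).filter
        (fun J => ∃ S ∈ D, ∀ i ∈ J, P i ∈ S)).sup Finset.card :=
    Finset.le_sup (f := Finset.card) (by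
      simp only [Finset.mem_filter, Finset.mem_univ, true_and]
      exact ⟨S, hS, fun i hi => hi⟩)
  have h2 : ((Finset.univ : Finset (Finset (Fin n))).filter
        (fun J => ∃ S ∈ D, ∀ i ∈ J, P i ∈ S)).sup Finset.card ≤ n :=
    Finset.sup_le fun J _ => by simpa using Finset.card_le_univ J
  convert (show n - ((Finset.univ : Finset (Finset (Fin n))).filter
        (fun J => ∃ S ∈ D, ∀ i ∈ J, P i ∈ S)).sup Finset.card +
        (Finset.univ.filter (fun i => P i ∈ S)).card ≤ n by omega)

/-- The preference-distance is attained by some member of a nonempty domain. -/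
lemma exists_prefDist_add_card_eq {A : Type*} {n : ℕ} [DecidableEq (Pref A)]
    {D : Finset (Finset (Pref A))} (hD : D.Nonempty) (P : Fin n → Pref A) :
    ∃ S ∈ D, prefDist D P + (Finset.univ.filter (fun i => P i ∈ S)).card = n := by
  classical
  have hne : ((Finset.univ : Finset (Finset (Fin n))).filter
      (fun J => ∃ S ∈ D, ∀ i ∈ J, P i ∈ S)).Nonempty := by
    obtain ⟨S, hS⟩ := hD
    exact ⟨∅, by simpa using ⟨S, hS⟩⟩
  obtain ⟨J, hJ, hJc⟩ := Finset.exists_mem_eq_sup _ hne Finset.card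
  obtain ⟨S, hS, hJS⟩ := (Finset.mem_filter.1 hJ).2
  refine ⟨S, hS, le_antisymm (prefDist_add_card_le D P hS) ?_⟩
  have h1 : J.card ≤ (Finset.univ.filter (fun i => P i ∈ S)).card :=
    Finset.card_le_card fun i hi => by simpa using hJS i hi
  have h2 : prefDist D P = n - J.card := by
    unfold prefDist
    rw [← hJc]
    congr!
  omega

/-- There are at most `|A| ^ |A|` preferences over `A`. -/
lemma card_pref_le {A : Type*} [Fintype A] [DecidableEq A] :
    Fintype.card (Pref A) ≤ Fintype.card A ^ Fintype.card A := by
  have hlt : ∀ (r : Pref A) (a : A),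
      (Finset.univ.filter (fun b => r.1 a b)).card < Fintype.card A := fun r a =>
    Finset.card_lt_univ_of_notMem (x := a) (by simpa using r.2.1 a)
  have hmono : ∀ (r : Pref A) (a b : A), r.1 a b →
      (Finset.univ.filter (fun c => r.1 b c)).card <
        (Finset.univ.filter (fun c => r.1 a c)).card := by
    intro r a b hab
    apply Finset.card_lt_card
    rw [Finset.ssubset_iff_of_subset]
    · exact ⟨b, by simpa using hab, by simpa using r.2.1 b⟩
    · intro c hc
      simp only [Finset.mem_filter, Finset.mem_univ, true_and] at hc ⊢
      exact r.2.2.1 a b c hab hc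
  have hiff : ∀ (r : Pref A) (a b : A), r.1 a b ↔
      (Finset.univ.filter (fun c => r.1 b c)).card <
        (Finset.univ.filter (fun c => r.1 a c)).card := by
    intro r a b
    refine ⟨hmono r a b, fun h => ?_⟩
    by_contra hab
    by_cases heq : a = b
    · subst heq; exact lt_irrefl _ h
    · rcases r.2.2.2 a b heq with h' | h'
      · exact hab h'
      · exact lt_asymm h (hmono r b a h')
  let f : Pref A → A → Fin (Fintype.card A) := fun r a => ⟨_, hlt r a⟩
  have hf : Function.Injective f := by
    intro r s hrs
    have hval : ∀ a, (Finset.univ.filter (fun c => r.1 a c)).card =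
        (Finset.univ.filter (fun c => s.1 a c)).card := fun a =>
      congrArg Fin.val (congrFun hrs a)
    apply Subtype.ext
    funext a b
    rw [Bool.eq_iff_iff, hiff r, hiff s, hval, hval]
  simpa using Fintype.card_le_of_injective f hf

/-- A family of sets of size at most `K` in a type of size `N` has at most `N ^ K + 1` members. -/
lemma card_family_le {B : Type*} [Fintype B] (D : Finset (Finset B)) (K : ℕ)
    (hK : ∀ S ∈ D, S.card ≤ K) : D.card ≤ Fintype.card B ^ K + 1 := by
  classical
  have hsub : D ⊆ insert ∅
      (Finset.univ.image (fun f : Fin K → B => Finset.univ.image f)) := by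
    intro S hS
    rcases S.eq_empty_or_nonempty with rfl | ⟨x, hx⟩
    · simp
    apply Finset.mem_insert_of_mem
    have hc : Fintype.card S ≤ Fintype.card (Fin K) := by simpa using hK S hS
    obtain ⟨e⟩ := Function.Embedding.nonempty_of_card_le hc
    have : Nonempty S := ⟨⟨x, hx⟩⟩
    obtain ⟨g, hsurj⟩ : ∃ g : Fin K → S, Function.Surjective g :=
      ⟨_, Function.invFun_surjective e.injective⟩
    refine Finset.mem_image.2 ⟨fun k => (g k : B), Finset.mem_univ _, ?_⟩
    ext y
    simp only [Finset.mem_image, Finset.mem_univ, true_and]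
    constructor
    · rintro ⟨k, rfl⟩
      exact (g k).2
    · intro hy
      obtain ⟨k, hk⟩ := hsurj ⟨y, hy⟩
      exact ⟨k, by rw [hk]⟩
  refine (Finset.card_le_card hsub).trans ((Finset.card_insert_le _ _).trans ?_)
  gcongr
  refine Finset.card_image_le.trans ?_
  simp

/-- A Chernoff-type bound for the sum of a uniform sample with replacement from a centred
list of numbers of modulus at most one and variance at most `1 / 4`. -/
lemma card_sample_sum_ge_le {n ℓ : ℕ} (Y : Fin n → ℝ) (hY : ∀ i, |Y i| ≤ 1)
    (hsum : ∑ i, Y i = 0) (hvar : ∑ i, Y i ^ 2 ≤ n / 4) {Δ : ℝ} (h0 : 0 ≤ Δ) (h1 : Δ ≤ 1) :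
    ((Finset.univ.filter (fun σ : Fin ℓ → Fin n => Δ * ℓ ≤ ∑ j, Y (σ j))).card : ℝ) ≤
      Real.exp (-(3 / 4 * Δ ^ 2 * ℓ)) * (n : ℝ) ^ ℓ := by
  have hstep : ∑ i, Real.exp (Δ * Y i) ≤ n * Real.exp (Δ ^ 2 / 4) := by
    have hi : ∀ i, Real.exp (Δ * Y i) ≤ 1 + Δ * Y i + Δ ^ 2 * Y i ^ 2 := by
      intro i
      have habs : |Δ * Y i| ≤ 1 := by
        rw [abs_mul, abs_of_nonneg h0]
        exact mul_le_one₀ h1 (abs_nonneg _) (hY i)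
      have := (abs_le.1 (Real.abs_exp_sub_one_sub_id_le habs)).2
      rw [mul_pow] at this
      linarith
    have hexp := Real.add_one_le_exp (Δ ^ 2 / 4)
    calc ∑ i, Real.exp (Δ * Y i) ≤ ∑ i, (1 + Δ * Y i + Δ ^ 2 * Y i ^ 2) :=
          Finset.sum_le_sum fun i _ => hi i
      _ = n + Δ ^ 2 * ∑ i, Y i ^ 2 := by
          simp [Finset.sum_add_distrib, ← Finset.mul_sum, hsum]
      _ ≤ n + Δ ^ 2 * (n / 4) := by gcongr
      _ = n * (Δ ^ 2 / 4 + 1) := by ring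
      _ ≤ n * Real.exp (Δ ^ 2 / 4) := by gcongr
  have hmgf : ∑ σ : Fin ℓ → Fin n, Real.exp (Δ * ∑ j, Y (σ j)) ≤
      (n : ℝ) ^ ℓ * Real.exp (Δ ^ 2 / 4 * ℓ) := by
    have : ∑ σ : Fin ℓ → Fin n, Real.exp (Δ * ∑ j, Y (σ j)) =
        (∑ i, Real.exp (Δ * Y i)) ^ ℓ := by
      simp_rw [Fintype.sum_pow, Finset.mul_sum, Real.exp_sum]
    rw [this, mul_comm (Δ ^ 2 / 4), Real.exp_nat_mul, ← mul_pow]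
    exact pow_le_pow_left₀ (Finset.sum_nonneg fun i _ => (Real.exp_pos _).le) hstep ℓ
  have hmarkov : ((Finset.univ.filter
      (fun σ : Fin ℓ → Fin n => Δ * ℓ ≤ ∑ j, Y (σ j))).card : ℝ) *
      Real.exp (Δ * (Δ * ℓ)) ≤ ∑ σ : Fin ℓ → Fin n, Real.exp (Δ * ∑ j, Y (σ j)) := by
    rw [← nsmul_eq_mul]
    refine (Finset.card_nsmul_le_sum _ (fun σ : Fin ℓ → Fin n => Real.exp (Δ * ∑ j, Y (σ j)))
      _ fun σ hσ => ?_).trans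
      (Finset.sum_le_sum_of_subset_of_nonneg (Finset.filter_subset _ _)
        fun σ _ _ => (Real.exp_pos _).le)
    have := (Finset.mem_filter.1 hσ).2
    gcongr
  refine le_of_mul_le_mul_right ((hmarkov.trans hmgf).trans_eq ?_)
    (Real.exp_pos (Δ * (Δ * ℓ)))
  rw [mul_right_comm, ← Real.exp_add, mul_comm]
  congr 2
  ring

/-- The frequency of a property in a uniform sample with replacement exceeds its frequency in
the population by `Δ`, or falls short of it by `Δ`, only with exponentially small probability. -/
lemma card_sample_frequency_deviation_le {n ℓ : ℕ} (hn : 1 ≤ n) (p : Fin n → Prop)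
    [DecidablePred p] {q : ℝ} (hq : ((Finset.univ.filter p).card : ℝ) = q * n)
    {Δ : ℝ} (h0 : 0 ≤ Δ) (h1 : Δ ≤ 1) :
    ((Finset.univ.filter (fun σ : Fin ℓ → Fin n => (q + Δ) * ℓ ≤
        ((Finset.univ.filter (fun j => p (σ j))).card : ℝ))).card : ℝ) ≤
      Real.exp (-(3 / 4 * Δ ^ 2 * ℓ)) * (n : ℝ) ^ ℓ ∧
    ((Finset.univ.filter (fun σ : Fin ℓ → Fin n =>
        ((Finset.univ.filter (fun j => p (σ j))).card : ℝ) ≤ (q - Δ) * ℓ)).card : ℝ) ≤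
      Real.exp (-(3 / 4 * Δ ^ 2 * ℓ)) * (n : ℝ) ^ ℓ := by
  have hn' : (0 : ℝ) < n := by exact_mod_cast hn
  have hq0 : 0 ≤ q := by
    by_contra! h
    have : (0 : ℝ) ≤ ((Finset.univ.filter p).card : ℝ) := by positivity
    nlinarith
  have hq1 : q ≤ 1 := by
    have : ((Finset.univ.filter p).card : ℝ) ≤ n := by
      exact_mod_cast (Finset.card_le_univ _).trans_eq (Fintype.card_fin n)
    by_contra! h
    nlinarith
  let Y : Fin n → ℝ := fun i => (if p i then 1 else 0) - q
  have hind : ∑ i, (if p i then (1 : ℝ) else 0) = q * n := by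
    rw [← hq]; simp
  have hY : ∀ i, |Y i| ≤ 1 := by
    intro i
    simp only [Y]
    rw [abs_le]
    split_ifs <;> constructor <;> linarith
  have hsum : ∑ i, Y i = 0 := by
    simp only [Y, Finset.sum_sub_distrib, hind]
    simp
    ring
  have hvar : ∑ i, Y i ^ 2 ≤ n / 4 := by
    have : ∀ i, Y i ^ 2 = (1 - 2 * q) * (if p i then (1 : ℝ) else 0) + q ^ 2 := by
      intro i
      simp only [Y]
      split_ifs <;> ring
    simp only [this, Finset.sum_add_distrib, ← Finset.mul_sum, hind]
    simp only [Finset.sum_const, Finset.card_univ, Fintype.card_fin, nsmul_eq_mul]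
    nlinarith [mul_nonneg hn'.le (sq_nonneg (1 - 2 * q))]
  have hcount : ∀ σ : Fin ℓ → Fin n, ∑ j, Y (σ j) =
      ((Finset.univ.filter (fun j => p (σ j))).card : ℝ) - q * ℓ := by
    intro σ
    simp only [Y, Finset.sum_sub_distrib]
    simp
    ring
  constructor
  · refine le_of_eq_of_le ?_ (card_sample_sum_ge_le Y hY hsum hvar h0 h1)
    congr 3
    ext σ
    rw [hcount, add_mul]
    constructor <;> intro h <;> linarith
  · refine le_of_eq_of_le ?_ (card_sample_sum_ge_le (fun i => - Y i) (by simpa using hY)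
      (by simp [hsum]) (by simpa using hvar) h0 h1)
    congr 3
    ext σ
    rw [Finset.sum_neg_distrib, hcount, sub_mul]
    constructor <;> intro h <;> linarith

/-- the relative preference-distance of a uniformly sampled subprofile is,
with probability at least `1-δ`, within `Δ` of the relative distance of the profile. -/
theorem stmt_7 {A : Type*} [Fintype A] [DecidableEq A] (m : ℕ) (hm : Fintype.card A = m)
    (hm2 : 2 ≤ m) (D : Finset (Finset (Pref A))) (K : ℕ) (hD : D.Nonempty)
    (hK : ∀ S ∈ D, S.card ≤ K) (hK1 : 1 ≤ K)
    (n : ℕ) (hn : 1 ≤ n) (P : Fin n → Pref A) (ε : ℝ) (hε0 : 0 < ε) (hε1 : ε < 1)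
    (hdist : (prefDist D P : ℝ) = ε * n)
    (Δ δ : ℝ) (hΔ0 : 0 < Δ) (hΔ : Δ < min ε (1 - ε)) (hδ0 : 0 < δ) (hδ1 : δ < 1)
    (ℓ : ℕ) (hℓ : (4 / Δ^2) * (K * m * Real.log m + Real.log (1/δ)) ≤ (ℓ : ℝ)) :
    pr (fun σ : Fin ℓ → Fin n =>
      (ε - Δ) * ℓ ≤ (prefDist D (fun j => P (σ j)) : ℝ) ∧
      (prefDist D (fun j => P (σ j)) : ℝ) ≤ (ε + Δ) * ℓ) ≥ 1 - δ := by
  classical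
  have hn' : (0 : ℝ) < n := by exact_mod_cast hn
  have hΔ1 : Δ ≤ 1 := (hΔ.trans_le (min_le_left _ _)).le.trans hε1.le
  set E : ℝ := Real.exp (-(3 / 4 * Δ ^ 2 * ℓ)) with hE
  let overshoot : Finset (Pref A) → Finset (Fin ℓ → Fin n) := fun S =>
    Finset.univ.filter fun σ => (1 - ε + Δ) * ℓ ≤
      ((Finset.univ.filter (fun j => P (σ j) ∈ S)).card : ℝ)
  have hover : ∀ S ∈ D, ((overshoot S).card : ℝ) ≤ E * (n : ℝ) ^ ℓ := by
    intro S hS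
    have hle : (prefDist D P : ℝ) + ((Finset.univ.filter (fun i => P i ∈ S)).card : ℝ) ≤ n := by
      exact_mod_cast prefDist_add_card_le D P hS
    have hq : ((Finset.univ.filter (fun i => P i ∈ S)).card : ℝ) =
        ((Finset.univ.filter (fun i => P i ∈ S)).card : ℝ) / n * n := by
      field_simp
    have hq' : ((Finset.univ.filter (fun i => P i ∈ S)).card : ℝ) / n ≤ 1 - ε := by
      rw [div_le_iff₀ hn']
      linarith
    refine le_trans ?_ (card_sample_frequency_deviation_le (ℓ := ℓ) hn _ hq hΔ0.le hΔ1).1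
    norm_cast
    refine Finset.card_le_card (Finset.monotone_filter_right _ fun σ _ hσ => ?_)
    refine le_trans ?_ hσ
    gcongr
  obtain ⟨T, hT, hTeq⟩ := exists_prefDist_add_card_eq hD P
  let undershoot : Finset (Fin ℓ → Fin n) := Finset.univ.filter fun σ =>
    ((Finset.univ.filter (fun j => P (σ j) ∈ T)).card : ℝ) ≤ (1 - ε - Δ) * ℓ
  have hunder : (undershoot.card : ℝ) ≤ E * (n : ℝ) ^ ℓ := by
    have hTeq' : (prefDist D P : ℝ) + ((Finset.univ.filter (fun i => P i ∈ T)).card : ℝ) = n := by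
      exact_mod_cast hTeq
    exact (card_sample_frequency_deviation_le hn (fun i => P i ∈ T) (q := 1 - ε)
      (by linarith) hΔ0.le hΔ1).2
  let good : Finset (Fin ℓ → Fin n) := Finset.univ.filter fun σ =>
      (ε - Δ) * ℓ ≤ (prefDist D (fun j => P (σ j)) : ℝ) ∧
      (prefDist D (fun j => P (σ j)) : ℝ) ≤ (ε + Δ) * ℓ
  have hcover : (Finset.univ : Finset (Fin ℓ → Fin n)) ⊆ good ∪ (D.biUnion overshoot ∪ undershoot) := by
    intro σ _
    by_contra hσ
    simp only [Finset.mem_union, Finset.mem_biUnion, not_or, not_exists, not_and] at hσ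
    obtain ⟨hg, ho, hu⟩ := hσ
    simp only [overshoot, undershoot, Finset.mem_filter, Finset.mem_univ, true_and, not_le] at ho hu
    refine hg (Finset.mem_filter.2 ⟨Finset.mem_univ _, ?_, ?_⟩)
    · obtain ⟨S, hS, hSeq⟩ := exists_prefDist_add_card_eq hD (fun j => P (σ j))
      have hSeq' : (prefDist D (fun j => P (σ j)) : ℝ) +
          ((Finset.univ.filter (fun j => P (σ j) ∈ S)).card : ℝ) = ℓ := by
        exact_mod_cast hSeq
      linarith [ho S hS]
    · have hle : (prefDist D (fun j => P (σ j)) : ℝ) +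
          ((Finset.univ.filter (fun j => P (σ j) ∈ T)).card : ℝ) ≤ ℓ := by
        exact_mod_cast prefDist_add_card_le D (fun j => P (σ j)) hT
      linarith
  have htotal : (n : ℝ) ^ ℓ ≤ good.card + (D.card + 1) * (E * (n : ℝ) ^ ℓ) := by
    have h1 : n ^ ℓ ≤ good.card + (∑ S ∈ D, (overshoot S).card + undershoot.card) := by
      have := (Finset.card_le_card hcover).trans (Finset.card_union_le _ _)
      rw [Finset.card_univ, Fintype.card_fun, Fintype.card_fin, Fintype.card_fin] at this
      refine this.trans ?_
      gcongr
      refine (Finset.card_union_le _ _).trans ?_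
      gcongr
      exact Finset.card_biUnion_le
    have h2 : ∑ S ∈ D, ((overshoot S).card : ℝ) ≤ D.card * (E * (n : ℝ) ^ ℓ) := by
      simpa using Finset.sum_le_card_nsmul D _ _ hover
    have h3 : (n : ℝ) ^ ℓ ≤ good.card + (∑ S ∈ D, ((overshoot S).card : ℝ) + undershoot.card) := by
      exact_mod_cast h1
    linarith
  have hbound : (D.card + 1) * E ≤ δ := by
    have hm0 : (0 : ℝ) < m := by exact_mod_cast (by omega : 0 < m)
    have hDcard : (D.card : ℝ) + 1 ≤ ((m : ℝ) ^ (m * K)) ^ 3 := by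
      have h1 : D.card ≤ m ^ (m * K) + 1 := by
        refine (card_family_le D K hK).trans ?_
        have := card_pref_le (A := A)
        rw [hm] at this
        rw [pow_mul]
        gcongr
      have h2 : 2 ≤ m ^ (m * K) :=
        hm2.trans (Nat.le_self_pow (Nat.mul_ne_zero (by omega) (by omega)) m)
      have h3 : D.card + 1 ≤ (m ^ (m * K)) ^ 3 := by
        generalize m ^ (m * K) = x at h1 h2
        nlinarith [Nat.mul_le_mul h2 h2, Nat.mul_le_mul (Nat.mul_le_mul h2 h2) (le_refl x)]
      exact_mod_cast h3
    have hexponent : 3 * (K * m * Real.log m + Real.log (1 / δ)) ≤ 3 / 4 * Δ ^ 2 * ℓ := by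
      have := mul_le_mul_of_nonneg_left hℓ (by positivity : 0 ≤ 3 / 4 * Δ ^ 2)
      refine le_of_eq_of_le ?_ this
      field_simp
    have hEle : E ≤ (((m : ℝ) ^ (m * K)) ^ 3)⁻¹ * δ ^ 3 := by
      have hpos : (0 : ℝ) < (((m : ℝ) ^ (m * K)) ^ 3)⁻¹ * δ ^ 3 := by positivity
      rw [← Real.exp_log hpos, hE, Real.exp_le_exp,
        Real.log_mul (by positivity) (by positivity), Real.log_inv, Real.log_pow, Real.log_pow,
        Real.log_pow]
      rw [one_div, Real.log_inv] at hexponent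
      push_cast
      linarith
    calc (D.card + 1) * E ≤
          ((m : ℝ) ^ (m * K)) ^ 3 * ((((m : ℝ) ^ (m * K)) ^ 3)⁻¹ * δ ^ 3) := by gcongr
      _ = δ ^ 3 := by
          rw [mul_inv_cancel_left₀]
          positivity
      _ ≤ δ := pow_le_of_le_one hδ0.le hδ1.le (by norm_num)
  have hpr : pr (fun σ : Fin ℓ → Fin n =>
      (ε - Δ) * ℓ ≤ (prefDist D (fun j => P (σ j)) : ℝ) ∧
      (prefDist D (fun j => P (σ j)) : ℝ) ≤ (ε + Δ) * ℓ) = (good.card : ℝ) / (n : ℝ) ^ ℓ := by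
    unfold pr
    rw [Fintype.card_fun, Fintype.card_fin, Fintype.card_fin, Nat.cast_pow]
    congr!
  have hnℓ : (0 : ℝ) < (n : ℝ) ^ ℓ := by positivity
  rw [hpr, ge_iff_le, le_div_iff₀ hnℓ]
  have := mul_le_mul_of_nonneg_right hbound hnℓ.le
  linarith
end

section
/- For every m ≥ 1 and every even n ≥ 4, there exist profiles P = (≻_1,…,≻_n) and Q = (≻′_1,…,≻′_n) over the 3m-element alternative set A = {a_j, b_j, c_j : j ∈ {1,…,m}} such that: ≻_i = ≻′_i for every i ≤ n−1 (P and Q differ only in the last preference); Q is single-peaked; for every X ⊆ A, if P restricted to A∖X is single-peaked then |X| ≥ m; and there exists X ⊆ A with |X| = m such that P restricted to A∖X is single-peaked (so the alternative-distance of P from the single-peaked profiles equals m). Concretely one may take ≻_i to be a_1 ≻ b_1 ≻ c_1 ≻ a_2 ≻ b_2 ≻ c_2 ≻ ⋯ ≻ a_m ≻ b_m ≻ c_m for i ≤ n/2; ≻_i to be c_m ≻ b_m ≻ a_m ≻ ⋯ ≻ c_1 ≻ b_1 ≻ a_1 for n/2 < i ≤ n−1; ≻_n to be a_1 ≻ c_1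 ≻ b_1 ≻ ⋯ ≻ a_m ≻ c_m ≻ b_m; and ≻′_n = ≻_1. -/
/-- The preference ranking the alternatives by increasing value of `f`. -/
def Pref.ofRank {A : Type*} (f : A → ℤ) (hf : Function.Injective f) : Pref A :=
  ⟨fun a b => decide (f a < f b), by
    refine ⟨fun a => by simp, fun a b c h₁ h₂ => ?_, fun a b h => ?_⟩
    · simp only [decide_eq_true_eq] at *
      exact h₁.trans h₂
    · simpa only [decide_eq_true_eq] using lt_or_gt_of_ne (hf.ne h)⟩

theorem Pref.asymm {A : Type*} (r : Pref A) {a b : A} (h : r.1 a b) : ¬ r.1 b a :=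
  fun h' => r.2.1 a (r.2.2.1 a b a h h')

theorem Pref.ne_of_lt {A : Type*} (r : Pref A) {a b : A} (h : r.1 a b) : a ≠ b := by
  rintro rfl
  exact r.2.1 a h

theorem Pref.exists_top {A : Type*} [Finite A] [Nonempty A] (r : Pref A) :
    ∃ t, ∀ z, z ≠ t → r.1 t z := by
  have : IsTrans A (fun a b => r.1 a b) := ⟨r.2.2.1⟩
  have : Std.Irrefl (fun a b : A => (r.1 a b : Prop)) := ⟨r.2.1⟩
  have hwf : WellFounded (fun a b : A => (r.1 a b : Prop)) :=
    Finite.wellFounded_of_trans_of_irrefl _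
  obtain ⟨t, -, ht⟩ := hwf.has_min Set.univ Set.univ_nonempty
  exact ⟨t, fun z hz => (r.2.2.2 z t hz).resolve_left (ht z trivial)⟩

theorem singlePeakedWrt_self {A : Type*} (ax : Pref A) : SinglePeakedWrt ax ax := by
  rintro t ht u v ((⟨-, h⟩ | ⟨-, h⟩) | ⟨rfl, h⟩)
  · exact h
  · exact absurd (ht u (ax.ne_of_lt h)) (ax.asymm h)
  · exact ht v h

theorem singlePeakedWrt_of_reverse {A : Type*} (ax r : Pref A)
    (hr : ∀ a b, r.1 a b ↔ ax.1 b a) : SinglePeakedWrt ax r := by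
  rintro t ht u v ((⟨h, -⟩ | ⟨h, -⟩) | ⟨rfl, h⟩)
  · exact absurd ((hr t u).1 (ht u (ax.ne_of_lt h).symm)) (ax.asymm h)
  · exact (hr u v).2 h
  · exact ht v h

/-- In a single-peaked preference, the alternative between two others on the axis is not
the worst of the three. -/
theorem SinglePeakedWrt.not_worst {A : Type*} [Finite A] {ax r : Pref A}
    (h : SinglePeakedWrt ax r) {x y z : A} (hxy : ax.1 x y) (hyz : ax.1 y z)
    (hrx : r.1 x y) (hrz : r.1 z y) : False := by
  have : Nonempty A := ⟨x⟩
  obtain ⟨t, ht⟩ := r.exists_top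
  by_cases hty : y = t
  · exact r.asymm hrx (h t ht y x (Or.inr ⟨hty, hty ▸ ax.ne_of_lt hxy⟩))
  · rcases ax.2.2.2 y t hty with h' | h'
    · exact r.asymm hrx (h t ht y x (Or.inl (Or.inr ⟨hxy, h'⟩)))
    · exact r.asymm hrz (h t ht y z (Or.inl (Or.inl ⟨h', hyz⟩)))

/-- A single-peaked profile has no triple in which each alternative is ranked worst by some
preference. -/
theorem not_isSinglePeaked_of_all_worst {A ι : Type*} [Finite A] {P : ι → Pref A}
    {x y z : A} {i j k : ι} (hix : (P i).1 y x) (hix' : (P i).1 z x)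
    (hjy : (P j).1 x y) (hjy' : (P j).1 z y) (hkz : (P k).1 x z) (hkz' : (P k).1 y z) :
    ¬ IsSinglePeaked P := by
  rintro ⟨ax, h⟩
  rcases ax.2.2.2 x y ((P j).ne_of_lt hjy) with h₁ | h₁ <;>
  rcases ax.2.2.2 y z ((P k).ne_of_lt hkz') with h₂ | h₂ <;>
  rcases ax.2.2.2 x z ((P k).ne_of_lt hkz) with h₃ | h₃
  · exact (h j).not_worst h₁ h₂ hjy hjy'
  · exact (h j).not_worst h₁ h₂ hjy hjy'
  · exact (h k).not_worst h₃ h₂ hkz hkz'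
  · exact (h i).not_worst h₃ h₁ hix' hix
  · exact (h i).not_worst h₁ h₃ hix hix'
  · exact (h k).not_worst h₂ h₃ hkz' hkz
  · exact (h j).not_worst h₂ h₁ hjy' hjy
  · exact (h j).not_worst h₂ h₁ hjy' hjy

/-- Rank of an alternative when blocks are listed in order, with positions inside each block
permuted by `σ`. -/
def blockRank {m : ℕ} (σ : Equiv.Perm (Fin 3)) (p : Fin m × Fin 3) : ℤ :=
  3 * (p.1 : ℕ) + ((σ p.2 : Fin 3) : ℕ)

theorem blockRank_injective {m : ℕ} (σ : Equiv.Perm (Fin 3)) :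
    Function.Injective (blockRank (m := m) σ) := by
  rintro ⟨a, i⟩ ⟨b, j⟩ h
  simp only [blockRank] at h
  have h₁ := (σ i).isLt
  have h₂ := (σ j).isLt
  have hab : a = b := Fin.ext (by omega)
  have hij : σ i = σ j := Fin.ext (by omega)
  rw [hab, σ.injective hij]

/-- The preference `a₁ ≻ b₁ ≻ c₁ ≻ a₂ ≻ ⋯ ≻ c_m`. -/
def forwardPref (m : ℕ) : Pref (Fin m × Fin 3) :=
  Pref.ofRank (blockRank 1) (blockRank_injective 1)

/-- The preference `c_m ≻ b_m ≻ a_m ≻ ⋯ ≻ a₁`. -/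
def backwardPref (m : ℕ) : Pref (Fin m × Fin 3) :=
  Pref.ofRank (fun p => -blockRank 1 p) (neg_injective.comp (blockRank_injective 1))

/-- The preference `a₁ ≻ c₁ ≻ b₁ ≻ a₂ ≻ ⋯ ≻ b_m`. -/
def swappedPref (m : ℕ) : Pref (Fin m × Fin 3) :=
  Pref.ofRank (blockRank (Equiv.swap 1 2)) (blockRank_injective _)

theorem backwardPref_iff (m : ℕ) (a b : Fin m × Fin 3) :
    (backwardPref m).1 a b ↔ (forwardPref m).1 b a := by
  simp [backwardPref, forwardPref, Pref.ofRank]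

theorem swappedPref_iff {m : ℕ} {a b : Fin m × Fin 3} (ha : a.2 ≠ 2) (hb : b.2 ≠ 2) :
    (swappedPref m).1 a b ↔ (forwardPref m).1 a b := by
  obtain ⟨a, i⟩ := a
  obtain ⟨b, j⟩ := b
  have h (k : Fin 3) (hk : k ≠ 2) : k = 0 ∨ k = 1 := by omega
  have h₀ : Equiv.swap (1 : Fin 3) 2 0 = 0 := by decide
  rcases h i ha with rfl | rfl <;> rcases h j hb with rfl | rfl <;>
    simp [swappedPref, forwardPref, Pref.ofRank, blockRank, h₀] <;> omega

/-- lower-bound construction for single-peakedness with alternative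
outliers: profiles `P`, `Q` over `3m` alternatives differing only in the last
preference, with `Q` single-peaked and `P` at alternative-distance exactly `m`. -/
theorem stmt_13 (m : ℕ) (hm : 1 ≤ m) (n : ℕ) (hn4 : 4 ≤ n) (hneven : Even n) :
    ∃ P Q : Fin n → Pref (Fin m × Fin 3),
      (∀ i : Fin n, (i : ℕ) < n - 1 → P i = Q i) ∧
      IsSinglePeaked Q ∧
      (∀ X : Finset (Fin m × Fin 3),
        IsSinglePeaked (fun i : Fin n => (P i).restrict Xᶜ) → m ≤ X.card) ∧
      (∃ X : Finset (Fin m × Fin 3), X.card = m ∧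
        IsSinglePeaked (fun i : Fin n => (P i).restrict Xᶜ)) := by
  let Q₀ : Fin n → Pref (Fin m × Fin 3) := fun i =>
    if (i : ℕ) < n / 2 then forwardPref m else backwardPref m
  refine ⟨fun i => if (i : ℕ) < n - 1 then Q₀ i else swappedPref m,
    fun i => if (i : ℕ) < n - 1 then Q₀ i else forwardPref m,
    fun i hi => by simp [hi], ⟨forwardPref m, fun i => ?_⟩, fun X hX => ?_,
    Finset.univ.image (fun j => (j, 2)), ?_, (forwardPref m).restrict _, fun i => ?_⟩
  · dsimp only [Q₀]
    split_ifs
    · exact singlePeakedWrt_self _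
    · exact singlePeakedWrt_of_reverse _ _ (backwardPref_iff m)
    · exact singlePeakedWrt_self _
  · have hit (j : Fin m) : ∃ x ∈ X, x.1 = j := by
      by_contra! hj
      have hmem (k : Fin 3) : (j, k) ∈ Xᶜ := by
        rw [Finset.mem_compl]
        exact fun hk => hj _ hk rfl
      have h₀ : Equiv.swap (1 : Fin 3) 2 0 = 0 := by decide
      have hlast : ¬ n - 2 < n / 2 := by omega
      have hlast' : n - 2 < n - 1 := by omega
      have hfirst : 0 < n / 2 := by omega
      have hfirst' : 0 < n - 1 := by omega
      refine not_isSinglePeaked_of_all_worst (x := ⟨(j, 0), hmem 0⟩) (y := ⟨(j, 1), hmem 1⟩)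
        (z := ⟨(j, 2), hmem 2⟩) (i := ⟨n - 2, by omega⟩) (j := ⟨n - 1, by omega⟩)
        (k := ⟨0, by omega⟩) ?_ ?_ ?_ ?_ ?_ ?_ hX <;>
      simp [Q₀, Pref.restrict, hlast, hlast', hfirst, hfirst', forwardPref, backwardPref,
        swappedPref, Pref.ofRank, blockRank, h₀]
    calc m = (Finset.univ : Finset (Fin m)).card := by simp
      _ ≤ (X.image Prod.fst).card := Finset.card_le_card fun j _ => by
          simpa only [Finset.mem_image] using hit j
      _ ≤ X.card := Finset.card_image_le
  · rw [Finset.card_image_of_injective _ (fun a b h => (Prod.ext_iff.1 h).1)]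
    simp
  · have hmem {a : Fin m × Fin 3}
        (ha : a ∈ (Finset.univ.image (fun j : Fin m => (j, (2 : Fin 3))))ᶜ) : a.2 ≠ 2 := by
      rintro h
      refine Finset.mem_compl.1 ha (Finset.mem_image.2 ⟨a.1, Finset.mem_univ _, ?_⟩)
      rw [← h]
    dsimp only [Q₀]
    split_ifs
    · exact singlePeakedWrt_self _
    · exact singlePeakedWrt_of_reverse _ _ fun a b => backwardPref_iff m a b
    · convert singlePeakedWrt_self _ using 1
      refine Subtype.ext (funext fun a => funext fun b => Bool.eq_iff_iff.2 ?_)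
      exact swappedPref_iff (hmem a.2) (hmem b.2)
end

section
/- For every m ≥ 1 and every n ≥ 8 divisible by 4, there exist profiles P = (≻_1,…,≻_n) and Q = (≻′_1,…,≻′_n) over the 3m-element alternative set A = {a_j, b_j, c_j : j ∈ {1,…,m}} such that: ≻_i = ≻′_i for every i ≤ n−1; Q is single-crossing; and for every X ⊆ A, if P restricted to A∖X is single-crossing then |X| ≥ m (so the alternative-distance of P from the single-crossing profiles is at least m). Concretely one may take, writing each preference as the concatenation of its blocks on {a_j,b_j,c_j} for j = 1,…,m: ≻_i with blocks a_j ≻ b_j ≻ c_j for 1 ≤ i ≤ n/4; blocks a_j ≻ c_j ≻ b_j for n/4 < i ≤ n/2; blocks c_j ≻ a_j ≻ b_j for n/2 < i ≤ 3n/4; blocks c_j ≻ b_j ≻ a_j for 3n/4 < i ≤ n−1; ≻_n with blocks b_j ≻ a_j ≻ c_j; and ≻′_n = ≻_1. -/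
/-- The preference ranking the blocks `{j} × Fin 3` by `j`, and each block by the rank function
`k` (smaller rank is better). -/
def blockPref (m : ℕ) (k : Fin 3 → Fin 3) (hk : Function.Injective k) : Pref (Fin m × Fin 3) :=
  ⟨fun u v => decide (u.1 < v.1 ∨ (u.1 = v.1 ∧ k u.2 < k v.2)), by
    refine ⟨?_, ?_, ?_⟩
    · simp
    · simp only [decide_eq_true_eq]
      intro a b c h1 h2
      grind
    · rintro ⟨a, x⟩ ⟨b, y⟩ h
      simp only [decide_eq_true_eq]
      have hxy : k x = k y → x = y := fun h => hk h
      grind⟩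

/-- The rank functions of the chain `abc, acb, cab, cba`. -/
def chainRank : Fin 4 → Fin 3 → Fin 3 :=
  ![![0, 1, 2], ![0, 2, 1], ![1, 2, 0], ![2, 1, 0]]

theorem chainRank_injective (l : Fin 4) : Function.Injective (chainRank l) := by
  revert l
  unfold Function.Injective
  decide

theorem chainRank_crossing (x y : Fin 3) (l₁ l₂ l₃ : Fin 4) (h₁ : l₁ ≤ l₂) (h₂ : l₂ ≤ l₃)
    (hl₁ : chainRank l₁ x < chainRank l₁ y) (hl₃ : chainRank l₃ x < chainRank l₃ y) :
    chainRank l₂ x < chainRank l₂ y := by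
  revert x y l₁ l₂ l₃
  decide

/-- The rank function of the order `bac`. -/
def outlierRank : Fin 3 → Fin 3 := ![1, 0, 2]

theorem outlierRank_injective : Function.Injective outlierRank := by
  unfold Function.Injective
  decide

theorem isSingleCrossing_blockPref_chain (m : ℕ) {n : ℕ} (level : Fin n → Fin 4) :
    IsSingleCrossing fun i => blockPref m (chainRank (level i)) (chainRank_injective _) := by
  refine ⟨(finCongr (Fintype.card_fin n)).trans (Tuple.sort level), ?_⟩
  intro a b i j k hij hjk hi hk
  have hmono := Tuple.monotone_sort level
  have h₁ := hmono (show finCongr (Fintype.card_fin n) i ≤ finCongr (Fintype.card_fin n) j from hij)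
  have h₂ := hmono (show finCongr (Fintype.card_fin n) j ≤ finCongr (Fintype.card_fin n) k from hjk)
  simp only [blockPref, decide_eq_true_eq] at hi hk ⊢
  rcases hi with hi | ⟨hab, hi⟩
  · exact Or.inl hi
  rcases hk with hk | ⟨-, hk⟩
  · exact Or.inl hk
  exact Or.inr ⟨hab, chainRank_crossing _ _ _ _ _ h₁ h₂ hi hk⟩

/-- If four voters realise all four combinations of opinions on two pairs of alternatives, then
the profile is not single-crossing. -/
theorem not_isSingleCrossing_of_four {A ι : Type*} [Fintype ι] {P : ι → Pref A} {a b c d : A}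
    {w x y z : ι} (hw : (P w).1 a b) (hw' : (P w).1 c d) (hx : (P x).1 a b) (hx' : (P x).1 d c)
    (hy : (P y).1 b a) (hy' : (P y).1 c d) (hz : (P z).1 b a) (hz' : (P z).1 d c) :
    ¬ IsSingleCrossing P := by
  rintro ⟨e, he⟩
  have between : ∀ (s t : A) (i j k : ι), (P i).1 s t → (P k).1 s t → (P j).1 t s →
      ¬ ((e.symm i : ℕ) ≤ e.symm j ∧ (e.symm j : ℕ) ≤ e.symm k) := by
    rintro s t i j k hi hk hj ⟨hij, hjk⟩
    have h := he s t (e.symm i) (e.symm j) (e.symm k) hij hjk (by simpa using hi)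
      (by simpa using hk)
    simp only [Equiv.apply_symm_apply] at h
    exact (P j).2.1 s ((P j).2.2.1 s t s h hj)
  have := between a b w y x hw hx hy
  have := between a b x y w hx hw hy
  have := between a b w z x hw hx hz
  have := between a b x z w hx hw hz
  have := between b a y w z hy hz hw
  have := between b a z w y hz hy hw
  have := between b a y x z hy hz hx
  have := between b a z x y hz hy hx
  have := between c d w x y hw' hy' hx'
  have := between c d y x w hy' hw' hx'
  have := between c d w z y hw' hy' hz'
  have := between c d y z w hy' hw' hz'
  have := between d c x w z hx' hz' hw'
  have := between d c z w x hz' hx' hw'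
  have := between d c x y z hx' hz' hy'
  have := between d c z y x hz' hx' hy'
  omega

/-- lower-bound construction for single-crossingness with alternative
outliers: profiles `P`, `Q` over `3m` alternatives differing only in the last
preference, with `Q` single-crossing and `P` at alternative-distance at least `m`. -/
theorem stmt_14 (m : ℕ) (hm : 1 ≤ m) (n : ℕ) (hn8 : 8 ≤ n) (hdiv : 4 ∣ n) :
    ∃ P Q : Fin n → Pref (Fin m × Fin 3),
      (∀ i : Fin n, (i : ℕ) < n - 1 → P i = Q i) ∧
      IsSingleCrossing Q ∧
      (∀ X : Finset (Fin m × Fin 3),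
        IsSingleCrossing (fun i : Fin n => (P i).restrict Xᶜ) → m ≤ X.card) := by
  obtain ⟨q, rfl⟩ := hdiv
  have hq : 0 < q := by omega
  let level : Fin (4 * q) → Fin 4 := fun i =>
    if (i : ℕ) < 4 * q - 1 then ⟨i / q, Nat.div_lt_of_lt_mul (by omega)⟩ else 0
  let Q : Fin (4 * q) → Pref (Fin m × Fin 3) := fun i =>
    blockPref m (chainRank (level i)) (chainRank_injective _)
  let P : Fin (4 * q) → Pref (Fin m × Fin 3) := fun i =>
    if (i : ℕ) < 4 * q - 1 then Q i else blockPref m outlierRank outlierRank_injective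
  refine ⟨P, Q, fun i hi => if_pos hi, isSingleCrossing_blockPref_chain m level, ?_⟩
  intro X hX
  by_contra! hcard
  obtain ⟨j, -, hj⟩ := Finset.exists_mem_notMem_of_card_lt_card
    (s := X.image Prod.fst) (t := (Finset.univ : Finset (Fin m)))
    (by simpa using Finset.card_image_le.trans_lt hcard)
  have hmem : ∀ x : Fin 3, (j, x) ∈ Xᶜ := fun x => by
    rw [Finset.mem_compl]
    exact fun h => hj (Finset.mem_image_of_mem Prod.fst h)
  have hP : ∀ l : Fin 4, ∀ hl : l * q < 4 * q - 1,
      P ⟨l * q, by omega⟩ = blockPref m (chainRank l) (chainRank_injective l) := by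
    intro l hl
    have hlevel : level ⟨l * q, by omega⟩ = l := by
      simp only [level, if_pos hl]
      exact Fin.ext (Nat.mul_div_cancel _ hq)
    simp only [P, if_pos hl, Q, hlevel]
  have hPlast : P ⟨4 * q - 1, by omega⟩ = blockPref m outlierRank outlierRank_injective :=
    if_neg (lt_irrefl _)
  have h₀ := hP 0 (by simp; omega)
  have h₁ := hP 1 (by simp; omega)
  have h₃ := hP 3 (by simp; omega)
  refine not_isSingleCrossing_of_four (a := ⟨_, hmem 0⟩) (b := ⟨_, hmem 1⟩) (c := ⟨_, hmem 1⟩)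
    (d := ⟨_, hmem 2⟩) (w := ⟨(0 : Fin 4) * q, by simp; omega⟩)
    (x := ⟨(1 : Fin 4) * q, by simp; omega⟩) (y := ⟨4 * q - 1, by omega⟩)
    (z := ⟨(3 : Fin 4) * q, by simp; omega⟩) ?_ ?_ ?_ ?_ ?_ ?_ ?_ ?_ hX
  all_goals
    simp only [h₀, h₁, h₃, hPlast, Pref.restrict, blockPref, decide_eq_true_eq]
    exact Or.inr ⟨trivial, by decide⟩
end
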